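/- arXiv:1208.3187 — 2 statements merged into one kernel-verified Lean document; each statement's English description precedes it below -/
import Mathlib

section
/- In the iidpnmrv setup with E^*[|X₁|] < ∞, let A be a non-empty proper subset of the interval [E_*[X₁], E^*[X₁]]. Then the set {ω ∈ Ω : limsup_{n→∞} Sₙ(ω)/n ∈ A} is maximally nonmeasurable: every P-measurable subset of it has P-measure 0 and every P-measurable superset of it has P-measure 1. -/
open MeasureTheory Filter Topology

/-- `flow` is a maximal measurable minorant of `f` with respect to the measure `P`. -/
def IsMeasMinorant {Ω : Type*} [MeasurableSpace Ω] (P : Measure Ω) (f flow : Ω → ℝ) : Prop :=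
  Measurable flow ∧ (∀ ω, flow ω ≤ f ω) ∧
    ∀ g : Ω → ℝ, Measurable g → (∀ ω, g ω ≤ f ω) → ∀ᵐ ω ∂P, g ω ≤ flow ω

/-- `fup` is a minimal measurable majorant of `f` with respect to the measure `P`. -/
def IsMeasMajorant {Ω : Type*} [MeasurableSpace Ω] (P : Measure Ω) (f fup : Ω → ℝ) : Prop :=
  Measurable fup ∧ (∀ ω, f ω ≤ fup ω) ∧
    ∀ h : Ω → ℝ, Measurable h → (∀ ω, f ω ≤ h ω) → ∀ᵐ ω ∂P, fup ω ≤ h ω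

open ProbabilityTheory

/-- A set meeting every measurable set of positive measure carries a probability measure (its trace)
which is pushed forward to the ambient one by the inclusion. -/
lemma exists_measure_subtype_map_eq {X : Type*} [MeasurableSpace X] (μ : Measure X) (E : Set X)
    (hE : ∀ C, MeasurableSet C → Disjoint C E → μ C = 0) :
    ∃ ν : Measure E, ν.map Subtype.val = μ := by
  have hle : (inferInstance : MeasurableSpace E) ≤
      (OuterMeasure.comap Subtype.val μ.toOuterMeasure).caratheodory := by
    rintro s ⟨C, hC, rfl⟩
    refine (OuterMeasure.isCaratheodory_iff _).2 fun t => ?_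
    simp only [OuterMeasure.comap_apply, Measure.coe_toOuterMeasure]
    rw [Set.image_inter_preimage, Set.image_sdiff_preimage, measure_inter_add_sdiff _ hC]
  refine ⟨(OuterMeasure.comap Subtype.val μ.toOuterMeasure).toMeasure hle, ?_⟩
  ext C hC
  rw [Measure.map_apply measurable_subtype_coe hC,
    toMeasure_apply _ _ (measurable_subtype_coe hC), OuterMeasure.comap_apply,
    Subtype.image_preimage_coe, Measure.coe_toOuterMeasure]
  refine le_antisymm (measure_mono Set.inter_subset_right) ?_
  set D := toMeasurable μ (E ∩ C) with hD
  have hCD : μ (C \ D) = 0 := by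
    refine hE _ (hC.diff (measurableSet_toMeasurable _ _)) ?_
    rw [Set.disjoint_left]
    exact fun x hx hxE => hx.2 (subset_toMeasurable _ _ ⟨hxE, hx.1⟩)
  calc
    μ C ≤ μ (D ∪ C \ D) := measure_mono (Set.subset_union_right.trans_eq Set.union_sdiff_self.symm)
    _ ≤ μ D + μ (C \ D) := measure_union_le _ _
    _ = μ (E ∩ C) := by rw [hCD, add_zero, hD, measure_toMeasurable]

/-- A product of sets of full outer measure has full outer measure for the product measure. -/
lemma infinitePi_eq_one_of_pi_subset {ι X : Type*} [MeasurableSpace X] (μ : Measure X)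
    [IsProbabilityMeasure μ] (E : ι → Set X)
    (hE : ∀ i C, MeasurableSet C → Disjoint C (E i) → μ C = 0)
    {B : Set (ι → X)} (hB : MeasurableSet B) (hEB : Set.univ.pi E ⊆ B) :
    Measure.infinitePi (fun _ : ι => μ) B = 1 := by
  choose ν hν using fun i => exists_measure_subtype_map_eq μ (E i) (hE i)
  have hprob (i : ι) : IsProbabilityMeasure (ν i) := by
    constructor
    rw [← Set.preimage_univ (f := (Subtype.val : E i → X)),
      ← Measure.map_apply measurable_subtype_coe MeasurableSet.univ, hν, measure_univ]
  have hmap := Measure.infinitePi_map_pi ν (f := fun i => (Subtype.val : E i → X))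
    (fun _ => measurable_subtype_coe)
  simp only [hν] at hmap
  rw [← hmap, Measure.map_apply (by fun_prop) hB]
  convert measure_univ (μ := Measure.infinitePi ν)
  exact Set.eq_univ_of_forall fun x => hEB fun i _ => (x i).2

/-- The set where `f` exceeds its maximal measurable minorant by at least `ε` has no measurable
subset of positive measure. -/
lemma IsMeasMinorant.measure_eq_zero {Ω : Type*} [MeasurableSpace Ω] {P : Measure Ω}
    {f flow : Ω → ℝ} (h : IsMeasMinorant P f flow) {ε : ℝ} (hε : 0 < ε) {C : Set Ω}
    (hC : MeasurableSet C) (hCf : ∀ x ∈ C, flow x + ε ≤ f x) : P C = 0 := by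
  classical
  have := h.2.2 (fun x => flow x + C.indicator (fun _ => ε) x)
    (h.1.add (measurable_const.indicator hC)) fun x => by
      by_cases hx : x ∈ C
      · simpa [hx] using hCf x hx
      · simpa [hx] using h.2.1 x
  refine measure_mono_null (fun x hx => ?_) this
  simp [hx, hε]

lemma IsMeasMajorant.neg {Ω : Type*} [MeasurableSpace Ω] {P : Measure Ω} {f fup : Ω → ℝ}
    (h : IsMeasMajorant P f fup) : IsMeasMinorant P (fun x => -f x) (fun x => -fup x) := by
  refine ⟨h.1.neg, fun x => neg_le_neg (h.2.1 x), fun g hg hgf => ?_⟩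
  filter_upwards [h.2.2 (fun x => -g x) hg.neg fun x => le_neg_of_le_neg (hgf x)] with x hx
  exact le_neg_of_le_neg hx

lemma IsMeasMinorant.integrable {Ω : Type*} [MeasurableSpace Ω] {P : Measure Ω}
    {f flow g : Ω → ℝ} (h : IsMeasMinorant P f flow) (hg : Measurable g)
    (hfg : ∀ x, |f x| ≤ g x) (hint : Integrable g P) : Integrable flow P := by
  refine hint.mono' h.1.aestronglyMeasurable ?_
  filter_upwards [h.2.2 (fun x => -g x) hg.neg fun x => (abs_le.1 (hfg x)).1] with x hx
  exact abs_le.2 ⟨hx, (h.2.1 x).trans (abs_le.1 (hfg x)).2⟩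

/-- The mixture of two copies of a measure, recording which copy a point comes from. -/
noncomputable def coinMixture {X : Type*} [MeasurableSpace X] (μ : Measure X) (a b : ℝ) :
    Measure (X × Bool) :=
  ENNReal.ofReal a • μ.map (fun x => (x, true)) + ENNReal.ofReal b • μ.map (fun x => (x, false))

lemma coinMixture_map_fst {X : Type*} [MeasurableSpace X] (μ : Measure X) {a b : ℝ}
    (ha : 0 ≤ a) (hb : 0 ≤ b) (hab : a + b = 1) : (coinMixture μ a b).map Prod.fst = μ := by
  rw [coinMixture, Measure.map_add _ _ measurable_fst, Measure.map_smul, Measure.map_smul,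
    Measure.map_map measurable_fst (by fun_prop), Measure.map_map measurable_fst (by fun_prop)]
  simp only [Function.comp_def, Measure.map_id']
  rw [← add_smul, ← ENNReal.ofReal_add ha hb, hab, ENNReal.ofReal_one, one_smul]

lemma coinMixture_isProbabilityMeasure {X : Type*} [MeasurableSpace X] (μ : Measure X)
    [IsProbabilityMeasure μ] {a b : ℝ} (ha : 0 ≤ a) (hb : 0 ≤ b) (hab : a + b = 1) :
    IsProbabilityMeasure (coinMixture μ a b) := by
  constructor
  rw [← Set.preimage_univ (f := (Prod.fst : X × Bool → X)),
    ← Measure.map_apply measurable_fst MeasurableSet.univ, coinMixture_map_fst μ ha hb hab,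
    measure_univ]

/-- The random variable equal to `f` on the first copy and to `g` on the second. -/
def coinSelect {X : Type*} (f g : X → ℝ) (z : X × Bool) : ℝ := if z.2 then f z.1 else g z.1

lemma measurable_coinSelect {X : Type*} [MeasurableSpace X] {f g : X → ℝ} (hf : Measurable f)
    (hg : Measurable g) : Measurable (coinSelect f g) :=
  Measurable.ite (measurable_snd (measurableSet_singleton true)) (hf.comp measurable_fst)
    (hg.comp measurable_fst)

section

variable {X : Type*} [MeasurableSpace X] {μ : Measure X} {f g : X → ℝ}

lemma integrable_map_coinSelect (hf : Measurable f) (hg : Measurable g) (hfi : Integrable f μ)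
    (hgi : Integrable g μ) (β : Bool) :
    Integrable (coinSelect f g) (μ.map (fun x => (x, β))) := by
  rw [integrable_map_measure (measurable_coinSelect hf hg).aestronglyMeasurable (by fun_prop)]
  cases β
  · simpa [Function.comp_def, coinSelect] using hgi
  · simpa [Function.comp_def, coinSelect] using hfi

lemma integrable_coinSelect (hf : Measurable f) (hg : Measurable g) (hfi : Integrable f μ)
    (hgi : Integrable g μ) (a b : ℝ) : Integrable (coinSelect f g) (coinMixture μ a b) :=
  ((integrable_map_coinSelect hf hg hfi hgi true).smul_measure ENNReal.ofReal_ne_top).add_measure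
    ((integrable_map_coinSelect hf hg hfi hgi false).smul_measure ENNReal.ofReal_ne_top)

lemma integral_coinSelect (hf : Measurable f) (hg : Measurable g) (hfi : Integrable f μ)
    (hgi : Integrable g μ) {a b : ℝ} (ha : 0 ≤ a) (hb : 0 ≤ b) :
    ∫ z, coinSelect f g z ∂(coinMixture μ a b) = a * ∫ x, f x ∂μ + b * ∫ x, g x ∂μ := by
  rw [coinMixture, integral_add_measure
      ((integrable_map_coinSelect hf hg hfi hgi true).smul_measure ENNReal.ofReal_ne_top)
      ((integrable_map_coinSelect hf hg hfi hgi false).smul_measure ENNReal.ofReal_ne_top),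
    integral_smul_measure, integral_smul_measure,
    integral_map (by fun_prop) (measurable_coinSelect hf hg).aestronglyMeasurable,
    integral_map (by fun_prop) (measurable_coinSelect hf hg).aestronglyMeasurable,
    ENNReal.toReal_ofReal ha, ENNReal.toReal_ofReal hb]
  simp [coinSelect]

end

/-- The set where `f` is within `ε` of the selected envelope has full outer measure. -/
lemma coinMixture_eq_zero_of_disjoint {X : Type*} [MeasurableSpace X] {μ : Measure X}
    {f flow fup : X → ℝ} (hlow : IsMeasMinorant μ f flow) (hup : IsMeasMajorant μ f fup)
    (a b : ℝ) {ε : ℝ} (hε : 0 < ε) {C : Set (X × Bool)} (hC : MeasurableSet C)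
    (hdisj : Disjoint C {z | |f z.1 - coinSelect flow fup z| ≤ ε}) : coinMixture μ a b C = 0 := by
  have hfar : ∀ z ∈ C, ε < |f z.1 - coinSelect flow fup z| := fun z hz =>
    not_le.1 (Set.disjoint_left.1 hdisj hz)
  have htrue : μ ((fun x => (x, true)) ⁻¹' C) = 0 := by
    refine hlow.measure_eq_zero hε (hC.preimage (by fun_prop)) fun x hx => ?_
    have h := hfar _ hx
    simp only [coinSelect, if_true] at h
    rw [abs_of_nonneg (sub_nonneg.2 (hlow.2.1 x))] at h
    linarith
  have hfalse : μ ((fun x => (x, false)) ⁻¹' C) = 0 := by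
    refine hup.neg.measure_eq_zero hε (hC.preimage (by fun_prop)) fun x hx => ?_
    have h := hfar _ hx
    simp only [coinSelect, Bool.false_eq_true, if_false] at h
    rw [abs_of_nonpos (sub_nonpos.2 (hup.2.1 x))] at h
    linarith
  simp [coinMixture, Measure.map_apply (show Measurable fun x : X => (x, true) by fun_prop) hC,
    Measure.map_apply (show Measurable fun x : X => (x, false) by fun_prop) hC, htrue, hfalse]

/-- The strong law of large numbers for the coordinates of an infinite product measure. -/
lemma ae_tendsto_average_infinitePi {X : Type*} [MeasurableSpace X] (μ : Measure X)
    [IsProbabilityMeasure μ] {Y : X → ℝ} (hY : Measurable Y) (hint : Integrable Y μ) :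
    ∀ᵐ ω ∂(Measure.infinitePi fun _ : ℕ => μ),
      Tendsto (fun n : ℕ => (∑ i ∈ Finset.range n, Y (ω i)) / n) atTop (𝓝 (∫ x, Y x ∂μ)) := by
  have hmp (i : ℕ) := measurePreserving_eval_infinitePi (fun _ : ℕ => μ) i
  have hindep := iIndepFun_infinitePi (P := fun _ : ℕ => μ) (X := fun _ => Y) (fun _ => hY)
  have hslln := strong_law_ae_real (μ := Measure.infinitePi fun _ : ℕ => μ)
    (fun i ω => Y (ω i)) ((hmp 0).integrable_comp_of_integrable hint)
    (fun i j hij => hindep.indepFun hij) fun i =>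
      { aemeasurable_fst := (hY.comp (measurable_pi_apply i)).aemeasurable
        aemeasurable_snd := (hY.comp (measurable_pi_apply 0)).aemeasurable
        map_eq := by
          have h (k : ℕ) : (Measure.infinitePi fun _ : ℕ => μ).map (fun ω => Y (ω k)) = μ.map Y :=
            (Measure.map_map hY (measurable_pi_apply k)).symm.trans
              (congrArg (Measure.map Y) (hmp k).map_eq)
          rw [h, h] }
  have hmean : ∫ ω, Y (ω 0) ∂(Measure.infinitePi fun _ : ℕ => μ) = ∫ x, Y x ∂μ := by
    rw [← Measure.infinitePi_map_eval (fun _ : ℕ => μ) 0,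
      integral_map (measurable_pi_apply 0).aemeasurable hY.aestronglyMeasurable,
      Measure.infinitePi_map_eval]
  rwa [hmean] at hslln

lemma tendsto_average_of_abs_sub_le {x y : ℕ → ℝ} {c : ℝ}
    (hxy : ∀ i, |x i - y i| ≤ 1 / ((i : ℝ) + 1))
    (hy : Tendsto (fun n : ℕ => (∑ i ∈ Finset.range n, y i) / n) atTop (𝓝 c)) :
    Tendsto (fun n : ℕ => (∑ i ∈ Finset.range n, x i) / n) atTop (𝓝 c) := by
  have hsub := (squeeze_zero_norm hxy tendsto_one_div_add_atTop_nhds_zero_nat).cesaro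
  refine (by simpa using hsub.add hy : Tendsto _ _ (𝓝 c)).congr fun n => ?_
  ring

/-- For every value between the lower and upper expectations, the set where the sample averages
converge to that value has full outer measure. -/
lemma infinitePi_eq_one_of_tendsto_average {X : Type*} [MeasurableSpace X] {μ : Measure X}
    [IsProbabilityMeasure μ] {f flow fup : X → ℝ}
    (hlow : IsMeasMinorant μ f flow) (hup : IsMeasMajorant μ f fup)
    (hlowi : Integrable flow μ) (hupi : Integrable fup μ) {c : ℝ}
    (hc : c ∈ Set.Icc (∫ x, flow x ∂μ) (∫ x, fup x ∂μ)) {B : Set (ℕ → X)} (hB : MeasurableSet B)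
    (hcB : ∀ ω : ℕ → X,
      Tendsto (fun n : ℕ => (∑ i ∈ Finset.range n, f (ω i)) / n) atTop (𝓝 c) → ω ∈ B) :
    Measure.infinitePi (fun _ : ℕ => μ) B = 1 := by
  rw [← segment_eq_Icc (hc.1.trans hc.2)] at hc
  obtain ⟨a, b, ha, hb, hab, rfl⟩ := hc
  have hprob := coinMixture_isProbabilityMeasure μ ha hb hab
  set Q := coinMixture μ a b with hQ
  have hmap := Measure.infinitePi_map_pi (fun _ : ℕ => Q) (f := fun _ => Prod.fst)
    (fun _ => measurable_fst)
  simp only [hQ, coinMixture_map_fst μ ha hb hab] at hmap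
  rw [← hmap, Measure.map_apply (by fun_prop) hB, ← hQ]
  have hslln := ae_tendsto_average_infinitePi Q (measurable_coinSelect hlow.1 hup.1)
    (integrable_coinSelect hlow.1 hup.1 hlowi hupi a b)
  rw [hQ, integral_coinSelect hlow.1 hup.1 hlowi hupi ha hb, ← hQ] at hslln
  obtain ⟨N, hN, hNm, hNnull⟩ := exists_measurable_superset_of_null (ae_iff.1 hslln)
  have hfst : Measurable fun (ω : ℕ → X × Bool) i => (ω i).1 := by fun_prop
  have hone := infinitePi_eq_one_of_pi_subset Q
    (fun i : ℕ => {z | |f z.1 - coinSelect flow fup z| ≤ 1 / ((i : ℝ) + 1)})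
    (fun i C hC hdisj => coinMixture_eq_zero_of_disjoint hlow hup a b
      Nat.one_div_pos_of_nat hC hdisj)
    ((hB.preimage hfst).union hNm) fun ω hω => by
      by_cases hωN : ω ∈ N
      · exact Or.inr hωN
      · refine Or.inl (hcB _ ?_)
        exact tendsto_average_of_abs_sub_le (fun i => hω i trivial)
          (not_not.1 fun h => hωN (hN h))
  exact le_antisymm prob_le_one
    (hone.ge.trans ((measure_union_le _ _).trans_eq (by rw [hNnull, add_zero])))

/-- In the iidpnmrv setup with integrable minimal measurable majorant of `|Ψ|`, for any nonempty proper subset `A` of `[E_*[X₁], E^*[X₁]]`, the set where `limsup Sₙ/n ∈ A` is maximally nonmeasurable. -/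
theorem limsup_mem_maximally_nonmeasurable
    {Ω₁ : Type*} [MeasurableSpace Ω₁] (P₁ : Measure Ω₁) [IsProbabilityMeasure P₁]
    (P : Measure (ℕ → Ω₁)) [IsProbabilityMeasure P]
    (hP : IsProjectiveLimit P (fun J : Finset ℕ => Measure.pi (fun _ : J => P₁)))
    (Ψ Ψlow Ψup Ψabs : Ω₁ → ℝ)
    (hΨlow : IsMeasMinorant P₁ Ψ Ψlow)
    (hΨup : IsMeasMajorant P₁ Ψ Ψup)
    (hΨabs : IsMeasMajorant P₁ (fun x => |Ψ x|) Ψabs)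
    (hInt : Integrable Ψabs P₁)
    (A : Set ℝ) (hA₁ : A.Nonempty)
    (hA₂ : A ⊆ Set.Icc (∫ x, Ψlow x ∂P₁) (∫ x, Ψup x ∂P₁))
    (hA₃ : A ≠ Set.Icc (∫ x, Ψlow x ∂P₁) (∫ x, Ψup x ∂P₁)) :
    (∀ B : Set (ℕ → Ω₁), MeasurableSet B →
        B ⊆ {ω : ℕ → Ω₁ | atTop.limsup (fun n : ℕ => (∑ i ∈ Finset.range n, Ψ (ω i)) / n) ∈ A} → P B = 0) ∧
    (∀ B : Set (ℕ → Ω₁), MeasurableSet B →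
        {ω : ℕ → Ω₁ | atTop.limsup (fun n : ℕ => (∑ i ∈ Finset.range n, Ψ (ω i)) / n) ∈ A} ⊆ B → P B = 1) := by
  have hP' : P = Measure.infinitePi fun _ : ℕ => P₁ :=
    hP.unique (Measure.isProjectiveLimit_infinitePi fun _ : ℕ => P₁)
  have hlowi := hΨlow.integrable hΨabs.1 hΨabs.2.1 hInt
  have hupi : Integrable Ψup P₁ := by
    simpa using (hΨup.neg.integrable hΨabs.1 (fun x => by simpa using hΨabs.2.1 x) hInt).neg
  have hfull : ∀ c ∈ Set.Icc (∫ x, Ψlow x ∂P₁) (∫ x, Ψup x ∂P₁), ∀ B : Set (ℕ → Ω₁),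
      MeasurableSet B →
      (∀ ω : ℕ → Ω₁,
        atTop.limsup (fun n : ℕ => (∑ i ∈ Finset.range n, Ψ (ω i)) / n) = c → ω ∈ B) →
      P B = 1 := by
    intro c hc B hB hcB
    rw [hP']
    exact infinitePi_eq_one_of_tendsto_average hΨlow hΨup hlowi hupi hc hB
      fun ω hω => hcB ω hω.limsup_eq
  constructor
  · intro B hB hBA
    obtain ⟨c, hc, hcA⟩ := Set.exists_of_ssubset (hA₂.ssubset_of_ne hA₃)
    rw [← prob_compl_eq_one_iff hB]
    exact hfull c hc _ hB.compl fun ω hω hωB => hcA (hω ▸ hBA hωB)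
  · intro B hB hAB
    obtain ⟨c, hc⟩ := hA₁
    exact hfull c (hA₂ hc) B hB fun ω hω => hAB (by simpa [hω] using hc)
end

section
/- Let (Ω, F, P) be a probability space and let f : Ω → ℝ be a simple function (taking only finitely many values), possibly nonmeasurable. Let f^* be a minimal measurable majorant of f with respect to P. Then there exists a σ-algebra F' on Ω with F ⊆ F' and f F'-measurable, and a probability measure Q on (Ω, F') agreeing with P on F, such that f = f^* Q-almost surely. -/
open MeasureTheory Filter Topology

/-- The σ-algebra of the sets whose trace on `D` is the trace of a set of `F`. -/
abbrev traceExtension {Ω : Type*} (F : MeasurableSpace Ω) (D : Set Ω) : MeasurableSpace Ω :=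
  (F.comap ((↑) : D → Ω)).map ((↑) : D → Ω)

lemma measurableSet_traceExtension_iff {Ω : Type*} {F : MeasurableSpace Ω} {D E : Set Ω} :
    MeasurableSet[traceExtension F D] E ↔ ∃ A, MeasurableSet[F] A ∧ A ∩ D = E ∩ D := by
  rw [traceExtension, MeasurableSpace.map_def, MeasurableSpace.measurableSet_comap]
  simp only [Subtype.preimage_val_eq_preimage_val_iff, Set.inter_comm]

lemma le_traceExtension {Ω : Type*} (F : MeasurableSpace Ω) (D : Set Ω) :
    F ≤ traceExtension F D :=
  fun E hE => measurableSet_traceExtension_iff.2 ⟨E, hE, rfl⟩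

lemma traceExtension_le_caratheodory_restrict {Ω : Type*} {F : MeasurableSpace Ω} (P : Measure Ω)
    (D : Set Ω) :
    traceExtension F D ≤ (OuterMeasure.restrict D P.toOuterMeasure).caratheodory := by
  intro E hE
  obtain ⟨A, hA, hAE⟩ := measurableSet_traceExtension_iff.1 hE
  rw [OuterMeasure.isCaratheodory_iff]
  intro t
  simp only [OuterMeasure.restrict_apply, Measure.coe_toOuterMeasure]
  have h (ω : Ω) : ω ∈ A ∧ ω ∈ D ↔ ω ∈ E ∧ ω ∈ D := Set.ext_iff.1 hAE ω
  have h₁ : t ∩ E ∩ D = t ∩ D ∩ A := by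
    ext ω
    have := h ω
    simp only [Set.mem_inter_iff]
    tauto
  have h₂ : t \ E ∩ D = (t ∩ D) \ A := by
    ext ω
    have := h ω
    simp only [Set.mem_inter_iff, Set.mem_sdiff]
    tauto
  rw [h₁, h₂, measure_inter_add_sdiff _ hA]

/-- A finite measure extends to the σ-algebra `traceExtension F D` so as to be concentrated on `D`,
provided every measurable set containing `D` has full measure. -/
lemma exists_extension_ae_mem {Ω : Type*} {F : MeasurableSpace Ω} (P : Measure Ω)
    [IsFiniteMeasure P] {D : Set Ω} (hD : P (toMeasurable P D)ᶜ = 0) :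
    ∃ Q : @Measure Ω (traceExtension F D),
      (∀ E : Set Ω, MeasurableSet[F] E → Q E = P E) ∧ ∀ᵐ ω ∂Q, ω ∈ D := by
  refine ⟨@OuterMeasure.toMeasure Ω (traceExtension F D) _
    (traceExtension_le_caratheodory_restrict P D), fun E hE => ?_, ?_⟩
  · rw [@toMeasure_apply Ω (traceExtension F D) _ _ _ (le_traceExtension F D E hE),
      OuterMeasure.restrict_apply, Measure.coe_toOuterMeasure, Set.inter_comm,
      ← Measure.measure_toMeasurable_inter hE (measure_ne_top P D), Set.inter_comm]
    exact measure_inter_conull hD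
  · have hm : MeasurableSet[traceExtension F D] Dᶜ :=
      measurableSet_traceExtension_iff.2 ⟨∅, MeasurableSet.empty, by simp⟩
    rw [ae_iff]
    change (@OuterMeasure.toMeasure Ω (traceExtension F D) _
      (traceExtension_le_caratheodory_restrict P D)) Dᶜ = 0
    rw [@toMeasure_apply Ω (traceExtension F D) _ _ _ hm]
    simp

lemma measurable_traceExtension_of_eqOn {Ω β : Type*} {F : MeasurableSpace Ω} [MeasurableSpace β]
    {D : Set Ω} {f g : Ω → β} (hg : Measurable[F] g) (hfg : Set.EqOn f g D) :
    Measurable[traceExtension F D] f := by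
  intro s hs
  refine measurableSet_traceExtension_iff.2 ⟨g ⁻¹' s, hg hs, ?_⟩
  ext ω
  simp only [Set.mem_inter_iff, Set.mem_preimage]
  exact and_congr_left fun h => by rw [hfg h]

/-- A measurable set on which a simple function lies strictly below its minimal measurable majorant
is null. -/
lemma IsMeasMajorant.measure_eq_zero_of_lt {Ω : Type*} [MeasurableSpace Ω] {P : Measure Ω}
    {f fup : Ω → ℝ} (hfup : IsMeasMajorant P f fup) (hf : (Set.range f).Finite) {B : Set Ω}
    (hB : MeasurableSet B) (hlt : ∀ ω ∈ B, f ω < fup ω) : P B = 0 := by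
  classical
  obtain ⟨hm, hle, hmin⟩ := hfup
  set S : ℝ → Set Ω := fun v =>
    B ∩ ({ω | v < fup ω} ∩ ⋂ w ∈ Set.range f, {ω | w < fup ω → w ≤ v}) with hS
  have hSm (v : ℝ) : MeasurableSet (S v) := by
    refine hB.inter ((measurableSet_lt measurable_const hm).inter
      (MeasurableSet.biInter hf.countable fun w _ => ?_))
    exact (measurableSet_lt measurable_const hm).imp (.const _)
  have hae (v : ℝ) : ∀ᵐ ω ∂P, fup ω ≤ (S v).piecewise (fun _ => v) fup ω := by
    refine hmin _ (measurable_const.piecewise (hSm v) hm) fun ω => ?_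
    by_cases hω : ω ∈ S v
    · rw [Set.piecewise_eq_of_mem _ _ _ hω]
      obtain ⟨hωB, -, h⟩ := hω
      exact Set.mem_iInter₂.1 h (f ω) ⟨ω, rfl⟩ (hlt ω hωB)
    · rw [Set.piecewise_eq_of_notMem _ _ _ hω]
      exact hle ω
  have hnull (v : ℝ) : P (S v) = 0 := by
    refine measure_mono_null (fun ω hω => ?_) (ae_iff.1 (hae v))
    rw [Set.mem_ofPred_eq, Set.piecewise_eq_of_mem _ _ _ hω, not_le]
    exact hω.2.1
  refine measure_mono_null (fun ω hω => ?_)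
    ((measure_biUnion_null_iff hf.countable).2 fun v _ => hnull v)
  obtain ⟨v, ⟨hvf, hv⟩, hmax⟩ := Set.exists_max_image {w ∈ Set.range f | w < fup ω} id
    (hf.subset (Set.sep_subset _ _)) ⟨f ω, ⟨ω, rfl⟩, hlt ω hω⟩
  exact Set.mem_biUnion hvf ⟨hω, hv, Set.mem_iInter₂.2 fun w hw hwlt => hmax w ⟨hw, hwlt⟩⟩

/-- **Extension making a simple function equal to its minimal measurable majorant.**
If `f` is a simple (finitely-valued, possibly nonmeasurable) function on a probability
space `(Ω, F, P)` and `fup` is a minimal measurable majorant of `f`, then there is an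
extension `Q` of `P` to a σ-algebra `F' ⊇ F` making `f` measurable such that `f = fup`
`Q`-almost surely. -/
theorem exists_extension_simple_eq_majorant
    {Ω : Type*} [F : MeasurableSpace Ω] (P : Measure Ω) [IsProbabilityMeasure P]
    (f fup : Ω → ℝ) (hf : (Set.range f).Finite)
    (hfup : IsMeasMajorant P f fup) :
    ∃ F' : MeasurableSpace Ω, F ≤ F' ∧ Measurable[F'] f ∧
      ∃ Q : @Measure Ω F', IsProbabilityMeasure Q ∧
        (∀ E : Set Ω, MeasurableSet[F] E → Q E = P E) ∧
        ∀ᵐ ω ∂Q, f ω = fup ω := by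
  have hlt : ∀ ω ∈ (toMeasurable P {ω | f ω = fup ω})ᶜ, f ω < fup ω := fun ω hω =>
    (hfup.2.1 ω).lt_of_ne fun h => hω (subset_toMeasurable P _ h)
  obtain ⟨Q, hQ, hae⟩ := exists_extension_ae_mem P
    (hfup.measure_eq_zero_of_lt hf (measurableSet_toMeasurable _ _).compl hlt)
  refine ⟨_, le_traceExtension F _, measurable_traceExtension_of_eqOn hfup.1 fun _ h => h, Q,
    ⟨?_⟩, hQ, hae⟩
  rw [hQ _ MeasurableSet.univ, measure_univ]
end
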